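/- Let Γ > 0 and let r be a positive integer. Define the real sequence λ_0 = 1/(r·e·Γ) and λ_{i+1} = λ_i + Γ·λ_i² for i ≥ 0. Then for every i with 0 ≤ i ≤ r, λ_i ≤ (1 + 1/r)^i · λ_0. In particular (applied to the sequence L_t with Γ = 1), the backward recursion L_{t_1} = 1/(e·r), L_{t−1} = L_t + L_t² over r steps stays bounded: 1/(e·r) ≤ L_t ≤ 1/r for all t_0 ≤ t ≤ t_1 with r = t_1 − t_0 + 1. -/

import Mathlib

open Real
open scoped BigOperators

noncomputable section

/-- The quadratic recursion `a, a + a², …`. -/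
def quadSeq (a : ℝ) : ℕ → ℝ
  | 0 => a
  | n + 1 => quadSeq a n + quadSeq a n ^ 2

/-- The backward sequence `L_t` on `[t₀, t₁]`: `L_{t₁} = 1/(e·r)` with
`r = t₁ − t₀ + 1`, and `L_{t-1} = L_t + L_t²`. -/
def Lseq (t₀ t₁ t : ℕ) : ℝ :=
  quadSeq (1 / (Real.exp 1 * ((t₁ - t₀ + 1 : ℕ) : ℝ))) (t₁ - t)

theorem one_add_one_div_pow_le_exp_one {r i : ℕ} (hr : 0 < r) (hi : i ≤ r) :
    (1 + 1 / (r : ℝ)) ^ i ≤ Real.exp 1 := by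
  have hr' : (0 : ℝ) < r := by exact_mod_cast hr
  have hbase : (1 : ℝ) + 1 / r ≤ Real.exp (1 / r) := by
    linarith [Real.add_one_le_exp (1 / (r : ℝ))]
  calc (1 + 1 / (r : ℝ)) ^ i ≤ (1 + 1 / (r : ℝ)) ^ r :=
        pow_le_pow_right₀ (by linarith [one_div_pos.mpr hr']) hi
    _ ≤ Real.exp (1 / r) ^ r := by gcongr
    _ = Real.exp 1 := by
        rw [← Real.exp_nat_mul, mul_one_div_cancel hr'.ne']

theorem le_of_quad_recursion {c : ℝ} (hc : 0 ≤ c) {x : ℕ → ℝ}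
    (hx : ∀ i, x (i + 1) = x i + c * x i ^ 2) (i : ℕ) : x 0 ≤ x i := by
  refine monotone_nat_of_le_succ (fun n => ?_) i.zero_le
  rw [hx]
  exact le_add_of_nonneg_right (by positivity)

theorem le_pow_mul_of_quad_recursion {c : ℝ} (hc : 0 < c) {r : ℕ} (hr : 0 < r) {x : ℕ → ℝ}
    (h0 : x 0 = 1 / ((r : ℝ) * Real.exp 1 * c))
    (hx : ∀ i, x (i + 1) = x i + c * x i ^ 2) :
    ∀ i ≤ r, x i ≤ (1 + 1 / (r : ℝ)) ^ i * x 0 := by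
  have hr' : (0 : ℝ) < r := by exact_mod_cast hr
  have hpos : 0 < x 0 := by rw [h0]; positivity
  intro i
  induction i with
  | zero => simp
  | succ k ih =>
    intro hk
    have hxk := ih (by lia)
    have hxk_nonneg : 0 ≤ x k := hpos.le.trans (le_of_quad_recursion hc.le hx k)
    have hcx : c * x k ≤ 1 / r := by
      calc c * x k ≤ c * (Real.exp 1 * x 0) := by
            gcongr
            exact hxk.trans (mul_le_mul_of_nonneg_right
              (one_add_one_div_pow_le_exp_one hr (by lia)) hpos.le)
        _ = 1 / r := by rw [h0]; field_simp
    calc x (k + 1) = (1 + c * x k) * x k := by rw [hx]; ring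
      _ ≤ (1 + 1 / (r : ℝ)) * ((1 + 1 / (r : ℝ)) ^ k * x 0) := by gcongr
      _ = (1 + 1 / (r : ℝ)) ^ (k + 1) * x 0 := by ring

/-- **Growth bound for the quadratic recursion.** If `λ_0 = 1/(r e Γ)` and
`λ_{i+1} = λ_i + Γ λ_i²`, then `λ_i ≤ (1 + 1/r)^i λ_0` for all `i ≤ r`. In particular
(with `Γ = 1`), the backward sequence `L_{t₁} = 1/(e·r)`, `L_{t-1} = L_t + L_t²` over
`r = t₁ − t₀ + 1` steps satisfies `1/(e·r) ≤ L_t ≤ 1/r` for all `t₀ ≤ t ≤ t₁`. -/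
theorem quad_recursion_growth_bound :
    (∀ Γ : ℝ, 0 < Γ → ∀ r : ℕ, 0 < r → ∀ lam : ℕ → ℝ,
      lam 0 = 1 / ((r : ℝ) * Real.exp 1 * Γ) →
      (∀ i, lam (i + 1) = lam i + Γ * lam i ^ 2) →
      ∀ i ≤ r, lam i ≤ (1 + 1 / (r : ℝ)) ^ i * lam 0)
    ∧ (∀ t₀ t₁ : ℕ, t₀ ≤ t₁ → ∀ t, t₀ ≤ t → t ≤ t₁ →
      1 / (Real.exp 1 * ((t₁ - t₀ + 1 : ℕ) : ℝ)) ≤ Lseq t₀ t₁ t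
      ∧ Lseq t₀ t₁ t ≤ 1 / ((t₁ - t₀ + 1 : ℕ) : ℝ)) := by
  refine ⟨fun Γ hΓ r hr lam h0 hlam => le_pow_mul_of_quad_recursion hΓ hr h0 hlam,
    fun t₀ t₁ _ t ht₀ _ => ?_⟩
  unfold Lseq
  have hi : t₁ - t ≤ t₁ - t₀ + 1 := by lia
  generalize t₁ - t = i at hi ⊢
  have hr : 0 < t₁ - t₀ + 1 := Nat.succ_pos _
  generalize t₁ - t₀ + 1 = r at hi hr ⊢
  have hr' : (0 : ℝ) < r := by exact_mod_cast hr
  set a : ℝ := 1 / (Real.exp 1 * (r : ℝ)) with ha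
  have ha_pos : 0 < a := by positivity
  have hrec : ∀ n, quadSeq a (n + 1) = quadSeq a n + 1 * quadSeq a n ^ 2 := fun n => by
    rw [one_mul, quadSeq]
  have h0 : quadSeq a 0 = 1 / ((r : ℝ) * Real.exp 1 * 1) := by
    rw [quadSeq, ha, mul_one, mul_comm]
  refine ⟨le_of_quad_recursion zero_le_one hrec i, ?_⟩
  calc quadSeq a i ≤ (1 + 1 / (r : ℝ)) ^ i * a :=
        le_pow_mul_of_quad_recursion one_pos hr h0 hrec i hi
    _ ≤ Real.exp 1 * a := by
        gcongr
        exact one_add_one_div_pow_le_exp_one hr hi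
    _ = 1 / r := by rw [ha]; field_simp

end
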